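/- Let A be a real symmetric positive definite n×n matrix whose off-diagonal entries are nonpositive (A_{ij} ≤ 0 for all i ≠ j). Then A is invertible and every entry of A⁻¹ is nonnegative. -/

import Mathlib

open scoped Matrix
/-- A real symmetric positive definite matrix with nonpositive
off-diagonal entries is invertible and has an entrywise-nonnegative inverse. -/
theorem inv_entries_nonneg_of_posDef_offDiag_nonpos {n : ℕ}
    (A : Matrix (Fin n) (Fin n) ℝ)
    (hsymm : A.IsSymm)
    (hpos : ∀ x : Fin n → ℝ, x ≠ 0 → 0 < x ⬝ᵥ (A *ᵥ x))
    (hoff : ∀ i j, i ≠ j → A i j ≤ 0) :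
    IsUnit A ∧ ∀ i j, 0 ≤ A⁻¹ i j := by
  have hu : IsUnit A := by
    rw [← Matrix.mulVec_injective_iff_isUnit]
    intro x y hxy
    by_contra hne
    have h := hpos (x - y) (sub_ne_zero.mpr hne)
    have hxy' : A *ᵥ x = A *ᵥ y := hxy
    rw [Matrix.mulVec_sub, hxy', sub_self, dotProduct_zero] at h
    exact lt_irrefl _ h
  refine ⟨hu, fun i j => ?_⟩
  by_contra hneg
  push Not at hneg
  -- column `j` of the inverse, and its negative part
  let x : Fin n → ℝ := fun k => A⁻¹ k j
  let m : Fin n → ℝ := fun k => max (-x k) 0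
  have hm0 : ∀ k, 0 ≤ m k := fun k => le_max_right _ _
  have hmne : m ≠ 0 := by
    intro h
    have h1 : m i = 0 := congrFun h i
    have h2 : -x i ≤ m i := le_max_left _ _
    have h3 : x i < 0 := hneg
    linarith
  have hAx : ∀ k, 0 ≤ (A *ᵥ x) k := by
    intro k
    have h : (A *ᵥ x) k = (A * A⁻¹) k j := rfl
    rw [h, Matrix.mul_nonsing_inv A ((Matrix.isUnit_iff_isUnit_det A).mp hu), Matrix.one_apply]
    split_ifs <;> norm_num
  have h1 : 0 ≤ m ⬝ᵥ (A *ᵥ x) :=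
    Finset.sum_nonneg fun k _ => mul_nonneg (hm0 k) (hAx k)
  have h2 : m ⬝ᵥ (A *ᵥ (x + m)) ≤ 0 := by
    simp only [dotProduct, Matrix.mulVec, Finset.mul_sum]
    refine Finset.sum_nonpos fun k _ => Finset.sum_nonpos fun l _ => ?_
    have hp : 0 ≤ (x + m) l := by
      have : -x l ≤ m l := le_max_left _ _
      simp only [Pi.add_apply]; linarith
    by_cases hkl : k = l
    · subst hkl
      have : m k * (x + m) k = 0 := by
        simp only [Pi.add_apply, m]
        rcases le_total (-x k) 0 with h | h
        · rw [max_eq_right h]; ring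
        · rw [max_eq_left h]; ring
      apply le_of_eq
      linear_combination A k k * this
    · exact mul_nonpos_of_nonneg_of_nonpos (hm0 k)
        (mul_nonpos_of_nonpos_of_nonneg (hoff k l hkl) hp)
  rw [Matrix.mulVec_add, dotProduct_add] at h2
  have h3 := hpos m hmne
  linarith
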